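/- The simple random walk on ℤ² is recurrent: for all x, y ∈ ℤ², P_x(τ_y < ∞) = 1. -/

import Mathlib

open scoped ENNReal

variable {X : Type*}

/-- `HitPath A B t` : the finite trajectory `t` ends in `A` and all its earlier
states avoid `A ∪ B`; it realizes the event "the walk hits `A` (strictly) before `B`". -/
def HitPath (A B : Set X) (t : List X) : Prop :=
  ∃ t' z, t = t' ++ [z] ∧ z ∈ A ∧ ∀ w ∈ t', w ∉ A ∪ B

/-- Probability weight of the finite trajectory `x :: l` for the chain with
transition probabilities `p`. -/
noncomputable def pathWt (p : X → X → ℝ≥0∞) : X → List X → ℝ≥0∞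
  | _, [] => 1
  | x, y :: l => p x y * pathWt p y l

open Classical in
/-- `P_x(τ_A < τ_B)`. -/
noncomputable def hitProb (p : X → X → ℝ≥0∞) (A B : Set X) (x : X) : ℝ≥0∞ :=
  ∑' l : List X, if HitPath A B (x :: l) then pathWt p x l else 0

open Classical in
/-- `P_a(τ_A⁺ > τ_B⁺)`: at positive times the walk hits `B` strictly before `A`. -/
noncomputable def escProb (p : X → X → ℝ≥0∞) (A B : Set X) (a : X) : ℝ≥0∞ :=
  ∑' l : List X, if HitPath B A l then pathWt p a l else 0

/-- Transition probabilities of the simple random walk on `ℤ^d`: jump to each of the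
`2d` nearest neighbours (at ℓ¹-distance 1) with probability `1/(2d)`. -/
noncomputable def srwP (d : ℕ) : (Fin d → ℤ) → (Fin d → ℤ) → ℝ≥0∞ :=
  fun x y => if (∑ k, (x k - y k).natAbs) = 1 then (2 * d : ℝ≥0∞)⁻¹ else 0

theorem tsum_list (G : List X → ℝ≥0∞) :
    ∑' l, G l = G [] + ∑' z, ∑' l, G (z :: l) := by
  let e : Unit ⊕ X × List X ≃ List X :=
    { toFun := Sum.elim (fun _ => []) fun q => q.1 :: q.2
      invFun := fun l => match l with
        | [] => .inl ()
        | z :: l => .inr (z, l)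
      left_inv := by rintro (_ | ⟨z, l⟩) <;> rfl
      right_inv := by rintro (_ | ⟨z, l⟩) <;> rfl }
  rw [← e.tsum_eq, Summable.tsum_sum ENNReal.summable ENNReal.summable, ENNReal.tsum_prod',
    tsum_fintype, Fintype.sum_unique]
  rfl

theorem hitPath_singleton_cons_self (y : X) (l : List X) :
    HitPath {y} ∅ (y :: l) ↔ l = [] := by
  constructor
  · rintro ⟨_ | ⟨a, t⟩, z, h, hz, hw⟩
    · simp at h; exact h.2
    · simp at h hw; exact absurd h.1.symm hw.1
  · rintro rfl
    exact ⟨[], y, by simp⟩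

theorem hitPath_singleton_cons_cons {x y : X} (hxy : x ≠ y) (z : X) (l : List X) :
    HitPath {y} ∅ (x :: z :: l) ↔ HitPath {y} ∅ (z :: l) := by
  constructor
  · rintro ⟨_ | ⟨a, t⟩, w, h, hz, hw⟩
    · simp at h
    · simp only [List.cons_append, List.cons.injEq] at h
      exact ⟨t, w, h.2, hz, fun v hv => hw v (List.mem_cons_of_mem _ hv)⟩
  · rintro ⟨t, w, h, hz, hw⟩
    refine ⟨x :: t, w, by simp [h], hz, ?_⟩
    simpa [hxy] using hw

theorem not_hitPath_singleton {x y : X} (hxy : x ≠ y) : ¬ HitPath {y} ∅ [x] := by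
  rintro ⟨_ | ⟨a, t⟩, w, h, hz, hw⟩
  · simp at h hz; exact hxy (h.trans hz)
  · simp at h

theorem hitProb_self (p : X → X → ℝ≥0∞) (y : X) : hitProb p {y} ∅ y = 1 := by
  simp only [hitProb, hitPath_singleton_cons_self]
  rw [tsum_eq_single [] fun l hl => if_neg hl]
  simp [pathWt]

theorem hitProb_eq_tsum (p : X → X → ℝ≥0∞) {x y : X} (hxy : x ≠ y) :
    hitProb p {y} ∅ x = ∑' z, p x z * hitProb p {y} ∅ z := by
  classical
  simp only [hitProb, ← ENNReal.tsum_mul_left]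
  rw [tsum_list, if_neg (not_hitPath_singleton hxy), zero_add]
  simp only [hitPath_singleton_cons_cons hxy, pathWt, mul_ite, mul_zero]

open Classical in
theorem tsum_hitPath_length_lt_le_one (p : X → X → ℝ≥0∞) (hp : ∀ x, ∑' z, p x z ≤ 1) (y : X)
    (n : ℕ) (x : X) :
    ∑' l : List X, (if l.length < n then
      (if HitPath {y} ∅ (x :: l) then pathWt p x l else 0) else 0) ≤ 1 := by
  induction n generalizing x with
  | zero => simp
  | succ n ih =>
    by_cases hxy : x = y
    · subst hxy
      simp only [hitPath_singleton_cons_self]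
      rw [tsum_eq_single [] fun l hl => by simp [hl]]
      simp [pathWt]
    · rw [tsum_list, if_neg (not_hitPath_singleton hxy), ite_self, zero_add]
      simp only [hitPath_singleton_cons_cons hxy, pathWt, List.length_cons, add_lt_add_iff_right]
      refine le_trans (ENNReal.tsum_le_tsum fun z => ?_) (hp x)
      calc _ = p x z * ∑' l : List X, (if l.length < n then
              (if HitPath {y} ∅ (z :: l) then pathWt p z l else 0) else 0) := by
            simp only [← ENNReal.tsum_mul_left, mul_ite, mul_zero]
        _ ≤ p x z * 1 := by gcongr; exact ih z
        _ = p x z := mul_one _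

theorem hitProb_le_one (p : X → X → ℝ≥0∞) (hp : ∀ x, ∑' z, p x z ≤ 1) (x y : X) :
    hitProb p {y} ∅ x ≤ 1 := by
  classical
  rw [hitProb, ENNReal.tsum_eq_iSup_sum]
  refine iSup_le fun s => le_trans ?_
    (tsum_hitPath_length_lt_le_one p hp y (s.sup List.length + 1) x)
  refine le_trans (Finset.sum_le_sum fun l hl => ?_) (ENNReal.sum_le_tsum s)
  rw [if_pos (Nat.lt_succ_of_le (Finset.le_sup (f := List.length) hl))]

theorem tsum_hitProb_le (p : X → X → ℝ≥0∞) (hp : ∀ x, ∑' z, p x z ≤ 1) (x y : X) :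
    ∑' z, p x z * hitProb p {y} ∅ z ≤ hitProb p {y} ∅ x := by
  by_cases hxy : x = y
  · rw [hxy, hitProb_self]
    refine le_trans (ENNReal.tsum_le_tsum fun z => ?_) (hp y)
    exact mul_le_of_le_one_right' (hitProb_le_one p hp z y)
  · exact (hitProb_eq_tsum p hxy).ge

theorem tsum_srwP_two_mul (a b : ℤ) (f : (Fin 2 → ℤ) → ℝ≥0∞) :
    ∑' z, srwP 2 ![a, b] z * f z =
      4⁻¹ * (f ![a + 1, b] + f ![a - 1, b] + f ![a, b + 1] + f ![a, b - 1]) := by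
  have key : ∀ z : Fin 2 → ℤ, z ∉ ({![a + 1, b], ![a - 1, b], ![a, b + 1], ![a, b - 1]} :
      Finset (Fin 2 → ℤ)) → srwP 2 ![a, b] z * f z = 0 := by
    intro z hz
    rw [srwP, if_neg, zero_mul]
    intro h
    simp [Fin.sum_univ_two, funext_iff, Fin.forall_fin_two] at h hz
    omega
  rw [tsum_eq_sum key, Finset.sum_insert, Finset.sum_insert, Finset.sum_insert,
    Finset.sum_singleton]
  · simp [srwP, Fin.sum_univ_two]
    norm_num
    ring
  all_goals
    simp [funext_iff, Fin.forall_fin_two]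
    try omega

/-- The piecewise logarithmic cutoff on `ℤ²`: the part of the harmonic sum up to `N` lying
beyond the sup norm of `x`. -/
noncomputable def logCutoff (N : ℕ) (x : ℤ × ℤ) : ℝ :=
  max (∑ i ∈ Finset.range N, 1 / ((i : ℝ) + 1) -
    ∑ i ∈ Finset.range (max x.1.natAbs x.2.natAbs), 1 / ((i : ℝ) + 1)) 0

theorem logCutoff_eq_zero {N : ℕ} {x : ℤ × ℤ} (hx : N ≤ max x.1.natAbs x.2.natAbs) :
    logCutoff N x = 0 := by
  refine max_eq_right (sub_nonpos.2 ?_)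
  exact Finset.sum_le_sum_of_subset_of_nonneg (Finset.range_subset_range.2 hx)
    fun i _ _ => by positivity

theorem hasFiniteSupport_of_eq_zero_of_natAbs_gt {f : ℤ × ℤ → ℝ} (N : ℕ)
    (hf : ∀ x : ℤ × ℤ, N < max x.1.natAbs x.2.natAbs → f x = 0) :
    (Function.support f).Finite := by
  refine ((Finset.range (N + 1)).biUnion fun n => (Finset.box n : Finset (ℤ × ℤ))).finite_toSet.subset
    fun x hx => ?_
  have : ¬ N < max x.1.natAbs x.2.natAbs := fun h => hx (hf x h)
  simp at this ⊢
  omega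

theorem abs_sum_range_sub_sum_range_le {m n : ℕ} (hmn : m ≤ n + 1) (hnm : n ≤ m + 1) :
    |∑ i ∈ Finset.range m, 1 / ((i : ℝ) + 1) - ∑ i ∈ Finset.range n, 1 / ((i : ℝ) + 1)| ≤
      1 / max 1 (m : ℝ) := by
  rcases (by omega : m = n ∨ m = n + 1 ∨ n = m + 1) with rfl | rfl | rfl
  · simp
  · rw [Finset.sum_range_succ, add_sub_cancel_left, abs_of_nonneg (by positivity)]
    push_cast
    rw [max_eq_right (by linarith [(Nat.cast_nonneg n : (0 : ℝ) ≤ n)])]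
  · rw [Finset.sum_range_succ, sub_add_cancel_left, abs_neg, abs_of_nonneg (by positivity)]
    have : (0 : ℝ) ≤ m := Nat.cast_nonneg m
    gcongr
    exact max_le (by linarith) (by linarith)

theorem logCutoff_sub_sq_le (N : ℕ) {x z : ℤ × ℤ}
    (hxz : max x.1.natAbs x.2.natAbs ≤ max z.1.natAbs z.2.natAbs + 1)
    (hzx : max z.1.natAbs z.2.natAbs ≤ max x.1.natAbs x.2.natAbs + 1) :
    (logCutoff N x - logCutoff N z) ^ 2 ≤
      1 / max 1 ((max x.1.natAbs x.2.natAbs : ℕ) : ℝ) ^ 2 := by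
  rw [← one_div_pow, ← sq_abs]
  refine pow_le_pow_left₀ (abs_nonneg _) ((abs_max_sub_max_le_abs _ _ _).trans ?_) 2
  rw [sub_sub_sub_cancel_left, abs_sub_comm]
  exact abs_sum_range_sub_sum_range_le hxz hzx

theorem tsum_logCutoff_sub_sq_le (N : ℕ) {e : ℤ × ℤ} (he : max e.1.natAbs e.2.natAbs ≤ 1) :
    ∑' x, (logCutoff N x - logCutoff N (x + e)) ^ 2 ≤
      1 + 8 * ∑ i ∈ Finset.range N, 1 / ((i : ℝ) + 1) := by
  have key : ∀ x ∉ (Finset.range (N + 1)).biUnion fun n => (Finset.box n : Finset (ℤ × ℤ)),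
      (logCutoff N x - logCutoff N (x + e)) ^ 2 = 0 := by
    intro x hx
    simp at hx he
    rw [logCutoff_eq_zero (by omega), logCutoff_eq_zero (by simp; omega)]
    simp
  rw [tsum_eq_sum key, Finset.sum_biUnion]
  · have hbox : ∀ n : ℕ, ∑ x ∈ (Finset.box n : Finset (ℤ × ℤ)),
        (logCutoff N x - logCutoff N (x + e)) ^ 2 ≤
        (Finset.box n : Finset (ℤ × ℤ)).card * (1 / max 1 (n : ℝ) ^ 2) := by
      intro n
      rw [← nsmul_eq_mul]
      refine Finset.sum_le_card_nsmul _ _ _ fun x hx => ?_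
      rw [Int.mem_box] at hx
      rw [← hx]
      refine logCutoff_sub_sq_le N ?_ ?_ <;> simp at he ⊢ <;> omega
    refine (Finset.sum_le_sum fun n _ => hbox n).trans ?_
    rw [Finset.sum_range_succ', add_comm, Finset.mul_sum]
    refine add_le_add (by simp) (Finset.sum_le_sum fun n _ => ?_)
    rw [Int.card_box n.succ_ne_zero]
    push_cast
    rw [max_eq_right (by linarith [(Nat.cast_nonneg n : (0 : ℝ) ≤ n)])]
    apply le_of_eq
    field_simp
  · intro m _ n _ hmn
    refine Finset.disjoint_left.2 fun x hm hn => hmn ?_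
    rw [Int.mem_box] at hm hn
    exact hm.symm.trans hn

theorem tendsto_logCutoff_div (x : ℤ × ℤ) :
    Filter.Tendsto (fun N => logCutoff N x / ∑ i ∈ Finset.range N, 1 / ((i : ℝ) + 1))
      Filter.atTop (nhds 1) := by
  have hH := Real.tendsto_sum_range_one_div_nat_succ_atTop
  have h1 := (tendsto_const_nhds (x := (1 : ℝ))).sub ((tendsto_const_nhds
    (x := ∑ i ∈ Finset.range (max x.1.natAbs x.2.natAbs), 1 / ((i : ℝ) + 1))).div_atTop hH)
  rw [sub_zero] at h1
  refine h1.congr' ?_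
  filter_upwards [hH.eventually_gt_atTop 0, hH.eventually_ge_atTop
    (∑ i ∈ Finset.range (max x.1.natAbs x.2.natAbs), 1 / ((i : ℝ) + 1))] with N h0 hN
  rw [logCutoff, max_eq_left (sub_nonneg.2 hN), sub_div, div_self h0.ne']

/-- Summation by parts for a finitely supported `F` in the direction `e`. -/
theorem tsum_mul_second_difference {G : Type*} [AddCommGroup G] (F g : G → ℝ)
    (hF : (Function.support F).Finite) (e : G) :
    ∑' x, F x * (2 * g x - g (x + e) - g (x - e)) =
      ∑' x, (F x - F (x + e)) * (g x - g (x + e)) := by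
  have hsum : ∀ k : G → ℝ, Summable fun x => F x * k x := fun k =>
    summable_of_hasFiniteSupport (hF.subset (Function.support_mul_subset_left _ _))
  have hsum' : Summable fun x => F (x + e) * (g (x + e) - g x) := by
    have := (Equiv.addRight e).summable_iff.2 (hsum fun x => g x - g (x - e))
    simpa [Function.comp_def] using this
  have hshift : ∑' x, F x * (g x - g (x - e)) = ∑' x, F (x + e) * (g (x + e) - g x) := by
    rw [← (Equiv.addRight e).tsum_eq]
    simp
  calc _ = ∑' x, (F x * (g x - g (x + e)) + F x * (g x - g (x - e))) :=
        tsum_congr fun x => by ring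
    _ = ∑' x, (F x * (g x - g (x + e)) + F (x + e) * (g (x + e) - g x)) := by
        rw [(hsum _).tsum_add (hsum _), hshift, (hsum _).tsum_add hsum']
    _ = _ := tsum_congr fun x => by ring

theorem sq_div_sub_sq_div_mul_sub {a b : ℝ} (ha : 0 < a) (hb : 0 < b) (s t : ℝ) :
    (s ^ 2 / a - t ^ 2 / b) * (a - b) = (s - t) ^ 2 - (s * b - t * a) ^ 2 / (a * b) := by
  field_simp
  ring

/-- Discrete Caccioppoli inequality for positive superharmonic functions on `ℤ²`. -/
theorem tsum_le_tsum_sub_sq_of_superharmonic {g : ℤ × ℤ → ℝ} (hg : ∀ x, 0 < g x)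
    (hsup : ∀ x, g (x + (1, 0)) + g (x - (1, 0)) + g (x + (0, 1)) + g (x - (0, 1)) ≤ 4 * g x)
    {φ : ℤ × ℤ → ℝ} (hφ : (Function.support φ).Finite) :
    ∑' x, (φ x * g (x + (1, 0)) - φ (x + (1, 0)) * g x) ^ 2 / (g x * g (x + (1, 0))) +
      ∑' x, (φ x * g (x + (0, 1)) - φ (x + (0, 1)) * g x) ^ 2 / (g x * g (x + (0, 1))) ≤
    ∑' x, (φ x - φ (x + (1, 0))) ^ 2 + ∑' x, (φ x - φ (x + (0, 1))) ^ 2 := by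
  set F : ℤ × ℤ → ℝ := fun x => φ x ^ 2 / g x
  have hF : (Function.support F).Finite := hφ.subset fun x hx hx0 => hx (by simp [F, hx0])
  have hsumF : ∀ k : ℤ × ℤ → ℝ, Summable fun x => F x * k x := fun k =>
    summable_of_hasFiniteSupport (hF.subset (Function.support_mul_subset_left _ _))
  have hsum : ∀ (e : ℤ × ℤ) (k : ℤ × ℤ → ℝ → ℝ → ℝ), (∀ x, k x 0 0 = 0) →
      Summable fun x => k x (φ x) (φ (x + e)) := by
    intro e k hk
    refine summable_of_hasFiniteSupport
      ((hφ.union (hφ.preimage (add_left_injective e).injOn)).subset fun x hx => ?_)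
    by_contra h
    simp only [Set.mem_union, Set.mem_preimage, Function.mem_support, not_or, not_not] at h
    exact hx (by simp [h.1, h.2, hk])
  have hdir : ∀ e, ∑' x, F x * (2 * g x - g (x + e) - g (x - e)) =
      ∑' x, (φ x - φ (x + e)) ^ 2 -
        ∑' x, (φ x * g (x + e) - φ (x + e) * g x) ^ 2 / (g x * g (x + e)) := by
    intro e
    rw [tsum_mul_second_difference F g hF, ← Summable.tsum_sub]
    · exact tsum_congr fun x => sq_div_sub_sq_div_mul_sub (hg _) (hg _) _ _
    · exact hsum e (fun _ s t => (s - t) ^ 2) (by simp)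
    · exact hsum e (fun x s t => (s * g (x + e) - t * g x) ^ 2 / (g x * g (x + e))) (by simp)
  have hnonneg : 0 ≤ ∑' x, F x * (2 * g x - g (x + (1, 0)) - g (x - (1, 0))) +
      ∑' x, F x * (2 * g x - g (x + (0, 1)) - g (x - (0, 1))) := by
    rw [← (hsumF _).tsum_add (hsumF _)]
    refine tsum_nonneg fun x => ?_
    rw [← mul_add]
    exact mul_nonneg (div_nonneg (sq_nonneg _) (hg x).le) (by linarith [hsup x])
  rw [hdir, hdir] at hnonneg
  linarith

theorem eq_add_of_superharmonic_of_pos {g : ℤ × ℤ → ℝ} (hg : ∀ x, 0 < g x)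
    (hsup : ∀ x, g (x + (1, 0)) + g (x - (1, 0)) + g (x + (0, 1)) + g (x - (0, 1)) ≤ 4 * g x)
    {e : ℤ × ℤ} (he : e = (1, 0) ∨ e = (0, 1)) (x : ℤ × ℤ) : g (x + e) = g x := by
  set H : ℕ → ℝ := fun N => ∑ i ∈ Finset.range N, 1 / ((i : ℝ) + 1)
  have hH : Filter.Tendsto H Filter.atTop Filter.atTop :=
    Real.tendsto_sum_range_one_div_nat_succ_atTop
  have hterm : ∀ N (e y : ℤ × ℤ), 0 ≤ (logCutoff N y * g (y + e) - logCutoff N (y + e) * g y) ^ 2 /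
      (g y * g (y + e)) := fun N e y => div_nonneg (sq_nonneg _) (mul_pos (hg _) (hg _)).le
  have hbound : ∀ N, (logCutoff N x * g (x + e) - logCutoff N (x + e) * g x) ^ 2 /
      (g x * g (x + e)) ≤ 2 * (1 + 8 * H N) := by
    intro N
    have hφ : (Function.support (logCutoff N)).Finite :=
      hasFiniteSupport_of_eq_zero_of_natAbs_gt N fun y hy => logCutoff_eq_zero hy.le
    have hsum : Summable fun y => (logCutoff N y * g (y + e) - logCutoff N (y + e) * g y) ^ 2 /
        (g y * g (y + e)) := by
      refine summable_of_hasFiniteSupport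
        ((hφ.union (hφ.preimage (add_left_injective e).injOn)).subset fun y hy => ?_)
      by_contra h
      simp only [Set.mem_union, Set.mem_preimage, Function.mem_support, not_or, not_not] at h
      exact hy (by simp [h.1, h.2])
    have h1 := tsum_le_tsum_sub_sq_of_superharmonic hg hsup hφ
    have h2 := tsum_logCutoff_sub_sq_le N (e := (1, 0)) (by simp)
    have h3 := tsum_logCutoff_sub_sq_le N (e := (0, 1)) (by simp)
    have h4 := hsum.le_tsum x fun y _ => hterm N e y
    have h5 := tsum_nonneg (L := .unconditional _) (hterm N (1, 0))
    have h6 := tsum_nonneg (L := .unconditional _) (hterm N (0, 1))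
    change _ ≤ 1 + 8 * H N at h2 h3
    rcases he with rfl | rfl <;> linarith
  have hlim := ((((tendsto_logCutoff_div x).mul_const (g (x + e))).sub
    ((tendsto_logCutoff_div (x + e)).mul_const (g x))).pow 2).div_const (g x * g (x + e))
  have hzero : Filter.Tendsto (fun N => 2 * ((1 / H N + 8) / H N)) Filter.atTop (nhds 0) := by
    have h := ((((tendsto_const_nhds (x := (1 : ℝ))).div_atTop hH).add_const 8).div_atTop
      hH).const_mul 2
    simpa using h
  have hle := le_of_tendsto_of_tendsto hlim hzero (by
    filter_upwards [hH.eventually_gt_atTop 0] with N hN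
    change (logCutoff N x / H N * g (x + e) - logCutoff N (x + e) / H N * g x) ^ 2 /
      (g x * g (x + e)) ≤ _
    calc _ = (logCutoff N x * g (x + e) - logCutoff N (x + e) * g x) ^ 2 /
          (g x * g (x + e)) / H N ^ 2 := by field_simp
      _ ≤ 2 * (1 + 8 * H N) / H N ^ 2 := by gcongr; exact hbound N
      _ = _ := by field_simp)
  have hpos := mul_pos (hg x) (hg (x + e))
  have h0 : (1 * g (x + e) - 1 * g x) ^ 2 ≤ 0 := by
    by_contra! h
    exact absurd hle (div_pos h hpos).not_ge
  have := pow_eq_zero_iff two_ne_zero |>.1 (h0.antisymm (sq_nonneg _))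
  linarith

/-- A nonnegative superharmonic function on `ℤ²` is constant. -/
theorem eq_of_superharmonic_of_nonneg {g : ℤ × ℤ → ℝ} (hg : ∀ x, 0 ≤ g x)
    (hsup : ∀ x, g (x + (1, 0)) + g (x - (1, 0)) + g (x + (0, 1)) + g (x - (0, 1)) ≤ 4 * g x)
    (x y : ℤ × ℤ) : g x = g y := by
  have hstep : ∀ {e : ℤ × ℤ}, e = (1, 0) ∨ e = (0, 1) → ∀ x, g (x + e) = g x := by
    intro e he x
    have := eq_add_of_superharmonic_of_pos (g := fun x => g x + 1)
      (fun x => by linarith [hg x]) (fun x => by linarith [hsup x]) he x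
    linarith
  have h1 : Function.Periodic g (1, 0) := hstep (.inl rfl)
  have h2 : Function.Periodic g (0, 1) := hstep (.inr rfl)
  have h0 : ∀ x, g x = g 0 := by
    intro x
    rw [← (h1.zsmul x.1) 0, ← (h2.zsmul x.2) (0 + x.1 • (1, 0))]
    simp
  rw [h0 x, h0 y]

/-- The simple random walk on `ℤ²` is recurrent: for all
`x, y ∈ ℤ²`, `P_x(τ_y < ∞) = 1`. -/
theorem srw_Z2_recurrent (x y : Fin 2 → ℤ) :
    hitProb (srwP 2) {y} ∅ x = 1 := by
  have hp : ∀ z, ∑' w, srwP 2 z w ≤ 1 := by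
    intro z
    have h := tsum_srwP_two_mul (z 0) (z 1) fun _ => 1
    have hz : ![z 0, z 1] = z := by ext i; fin_cases i <;> rfl
    simp only [mul_one, hz] at h
    rw [h, show (1 + 1 + 1 + 1 : ℝ≥0∞) = 4 by norm_num,
      ENNReal.inv_mul_cancel (by simp) (by simp)]
  have hfin : ∀ z, hitProb (srwP 2) {y} ∅ z ≠ ⊤ := fun z =>
    ne_top_of_le_ne_top ENNReal.one_ne_top (hitProb_le_one _ hp z y)
  have hconst := eq_of_superharmonic_of_nonneg
    (g := fun q => (hitProb (srwP 2) {y} ∅ ![q.1, q.2]).toReal)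
    (fun _ => ENNReal.toReal_nonneg) (fun q => by
      have h := tsum_hitProb_le _ hp ![q.1, q.2] y
      rw [tsum_srwP_two_mul] at h
      have h' := ENNReal.toReal_mono (hfin _) h
      simp only [ENNReal.toReal_mul, ENNReal.toReal_add, hfin, ne_eq, not_false_eq_true,
        ENNReal.add_eq_top, or_self, ENNReal.toReal_inv, ENNReal.toReal_ofNat] at h'
      simp only [Prod.fst_add, Prod.snd_add, Prod.fst_sub, Prod.snd_sub, add_zero, sub_zero]
      linarith)
    (x 0, x 1) (y 0, y 1)
  have hz : ∀ z : Fin 2 → ℤ, ![z 0, z 1] = z := fun z => by ext i; fin_cases i <;> rfl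
  simp only [hz, hitProb_self] at hconst
  exact (ENNReal.toReal_eq_toReal_iff' (hfin x) ENNReal.one_ne_top).1 hconst
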